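/- Sears' first ${}_4\phi_3$ transformation: Let $n \ge 0$ be an integer and let $q, a, b, c, d, e, f$ be nonzero complex numbers satisfying $def = abcq^{1-n}$, such that all factors occurring in denominators below are nonzero. Then $\sum_{k=0}^{n} \frac{(q^{-n};q)_k (a;q)_k (b;q)_k (c;q)_k}{(q;q)_k (d;q)_k (e;q)_k (f;q)_k} q^k = \frac{(e/a;q)_n (f/a;q)_n}{(e;q)_n (f;q)_n} a^n \sum_{k=0}^{n} \frac{(q^{-n};q)_k (a;q)_k (d/b;q)_k (d/c;q)_k}{(q;q)_k (d;q)_k (aq^{1-n}/e;q)_k (aq^{1-n}/f;q)_k} q^k$. -/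

import Mathlib

set_option autoImplicit false

/-- The q-shifted factorial `(a;q)_n = ∏_{j=0}^{n-1} (1 - a q^j)`. -/
noncomputable def qPoch (q a : ℂ) (n : ℕ) : ℂ := ∏ j ∈ Finset.range n, (1 - a * q ^ j)

lemma qPoch_zero (q a : ℂ) : qPoch q a 0 = 1 := by simp [qPoch]

lemma qPoch_succ (q a : ℂ) (n : ℕ) :
    qPoch q a (n + 1) = qPoch q a n * (1 - a * q ^ n) := by
  simp [qPoch, Finset.prod_range_succ]

lemma qPoch_add (q a : ℂ) (m n : ℕ) :
    qPoch q a (m + n) = qPoch q a m * qPoch q (a * q ^ m) n := by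
  simp only [qPoch, Finset.prod_range_add]
  congr 1
  exact Finset.prod_congr rfl fun j _ => by ring

lemma qPoch_ne_zero_of_le {q a : ℂ} {m n : ℕ} (hmn : m ≤ n) (h : qPoch q a n ≠ 0) :
    qPoch q a m ≠ 0 := by
  obtain ⟨k, rfl⟩ := Nat.exists_eq_add_of_le hmn
  rw [qPoch_add] at h
  exact left_ne_zero_of_mul h

/-- Reversal of the order of factors in a q-shifted factorial. -/
lemma qPoch_reverse {q z : ℂ} (hq : q ≠ 0) (hz : z ≠ 0) (i j : ℕ) :
    qPoch q (q ^ (1 - ((i + j : ℕ) : ℤ)) / z) j * z ^ j * qPoch q z i =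
      (-1) ^ j * q ^ (j.choose 2) * (q ^ (1 - ((i + j : ℕ) : ℤ))) ^ j * qPoch q z (i + j) := by
  obtain ⟨n, hn⟩ : ∃ n, n = i + j := ⟨_, rfl⟩
  rw [← hn]
  induction j generalizing i with
  | zero => simp [qPoch_zero, hn]
  | succ j ih =>
    have h := ih (i + 1) (by omega)
    rw [qPoch_succ q z i] at h
    have hp : q ^ (1 - (n : ℤ)) * (q ^ j * q ^ i) = 1 := by
      rw [← pow_add, ← zpow_natCast, ← zpow_add₀ hq, hn]
      push_cast
      convert zpow_zero q using 2
      ring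
    rw [qPoch_succ, Nat.choose_succ_succ' j 1, Nat.choose_one_right]
    set p := q ^ (1 - (n : ℤ))
    have hz' : (1 - p / z * q ^ j) * z = -(p * q ^ j) * (1 - z * q ^ i) := by
      field_simp
      linear_combination -z * hp
    calc _ = qPoch q (p / z) j * z ^ j * qPoch q z i * ((1 - p / z * q ^ j) * z) := by ring
      _ = _ := by
        rw [hz']
        simp only [Nat.reduceAdd, pow_add, pow_succ] at *
        linear_combination (-(p * q ^ j)) * h

/-- Summand in the convolution form of the q-Pfaff–Saalschütz sum. -/
noncomputable def saalschutzTerm (q A B w : ℂ) (k j : ℕ) : ℂ :=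
  qPoch q A j * qPoch q B j * qPoch q w (k - j) * w ^ j /
    (qPoch q q j * qPoch q (A * B * w) j * qPoch q q (k - j))

lemma saalschutzTerm_telescope {q A B w : ℂ} {k : ℕ} (hqk : qPoch q q (k + 1) ≠ 0)
    (hC : qPoch q (A * B * w) (k + 1) ≠ 0) (m : ℕ) (hm : m ≤ k) :
    ∑ j ∈ Finset.range (m + 1),
        ((1 - A * B * w * q ^ k) * (1 - q ^ (k + 1)) * saalschutzTerm q A B w (k + 1) j -
          (1 - w * A * q ^ k) * (1 - w * B * q ^ k) * saalschutzTerm q A B w k j) =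
      -q ^ (k - m) * (qPoch q A (m + 1) * qPoch q B (m + 1) * qPoch q w (k - m) * w ^ (m + 1) /
        (qPoch q q m * qPoch q (A * B * w) m * qPoch q q (k - m))) := by
  induction m with
  | zero =>
    have h1 := qPoch_ne_zero_of_le (Nat.le_succ k) hqk
    have h2 : 1 - q * q ^ k ≠ 0 := by
      rw [qPoch_succ] at hqk; exact right_ne_zero_of_mul hqk
    simp only [zero_add, Finset.sum_range_one, saalschutzTerm, Nat.sub_zero, qPoch_zero,
      qPoch_succ, pow_zero, mul_one, one_mul, pow_succ]
    generalize q ^ k = x at *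
    generalize hD : 1 - q * x = D at *
    field_simp
    rw [← hD]
    ring
  | succ m ih =>
    rw [Finset.sum_range_succ, ih (by omega)]
    obtain ⟨i, rfl⟩ := Nat.exists_eq_add_of_le hm
    have e1 : m + 1 + i - m = i + 1 := by omega
    have e2 : m + 1 + i - (m + 1) = i := by omega
    have e3 : m + 1 + i + 1 - (m + 1) = i + 1 := by omega
    have h1 : qPoch q q (m + 1) ≠ 0 := qPoch_ne_zero_of_le (by omega) hqk
    have h2 : qPoch q q (i + 1) ≠ 0 := qPoch_ne_zero_of_le (by omega) hqk
    have h3 : qPoch q (A * B * w) (m + 1) ≠ 0 := qPoch_ne_zero_of_le (by omega) hC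
    simp only [saalschutzTerm, e1, e2, e3]
    simp only [qPoch_succ] at *
    have h1a := left_ne_zero_of_mul h1
    have h1b := right_ne_zero_of_mul h1
    have h2a := left_ne_zero_of_mul h2
    have h2b := right_ne_zero_of_mul h2
    have h3a := left_ne_zero_of_mul h3
    have h3b := right_ne_zero_of_mul h3
    simp only [pow_add, pow_succ]
    clear ih hqk hC h1 h2 h3
    generalize q ^ m = x at *
    generalize q ^ i = y at *
    generalize hD₁ : 1 - q * x = D₁ at *
    generalize hD₂ : 1 - q * y = D₂ at *
    generalize hD₃ : 1 - A * B * w * x = D₃ at *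
    field_simp
    rw [← hD₁, ← hD₂, ← hD₃]
    ring

/-- The q-Pfaff–Saalschütz sum in convolution form. -/
lemma sum_saalschutzTerm {q A B w : ℂ} {k : ℕ} (hqk : qPoch q q k ≠ 0)
    (hC : qPoch q (A * B * w) k ≠ 0) :
    ∑ j ∈ Finset.range (k + 1), saalschutzTerm q A B w k j =
      qPoch q (w * A) k * qPoch q (w * B) k / (qPoch q q k * qPoch q (A * B * w) k) := by
  induction k with
  | zero => simp [saalschutzTerm, qPoch_zero]
  | succ k ih =>
    have h1 := qPoch_ne_zero_of_le (Nat.le_succ k) hqk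
    have h2 := qPoch_ne_zero_of_le (Nat.le_succ k) hC
    have ht := saalschutzTerm_telescope hqk hC k le_rfl
    rw [Finset.sum_sub_distrib, ← Finset.mul_sum, ← Finset.mul_sum, ih h1 h2] at ht
    rw [Finset.sum_range_succ]
    simp only [saalschutzTerm, Nat.sub_self, qPoch_zero] at *
    simp only [qPoch_succ] at *
    have h3 := right_ne_zero_of_mul hqk
    have h4 := right_ne_zero_of_mul hC
    rw [← sub_eq_zero] at ht ⊢
    have h5 : (1 - A * B * w * q ^ k) * (1 - q * q ^ k) ≠ 0 := mul_ne_zero h4 h3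
    refine (mul_eq_zero.mp ?_).resolve_left h5
    rw [← ht, pow_succ q]
    clear ht hqk hC ih
    generalize q ^ k = x at *
    generalize hD₁ : 1 - q * x = D₁ at *
    generalize hD₂ : 1 - A * B * w * x = D₂ at *
    field_simp
    rw [← hD₁, ← hD₂]
    ring

/-- The q-Pfaff–Saalschütz sum. -/
lemma q_pfaff_saalschutz {q A Y E F : ℂ} {N : ℕ} (hq : q ≠ 0) (hA : A ≠ 0) (hY : Y ≠ 0)
    (hE : E ≠ 0) (hF : F ≠ 0) (hbal : E * F = A * Y * q ^ (1 - (N : ℤ)))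
    (hqN : qPoch q q N ≠ 0) (hEN : qPoch q E N ≠ 0) (hFN : qPoch q F N ≠ 0) :
    ∑ m ∈ Finset.range (N + 1),
      qPoch q (q ^ (-(N : ℤ))) m * qPoch q A m * qPoch q Y m * q ^ m /
        (qPoch q q m * qPoch q E m * qPoch q F m) =
      qPoch q (E / A) N * qPoch q (F / A) N * A ^ N / (qPoch q E N * qPoch q F N) := by
  obtain ⟨w, hw⟩ : ∃ w, w = E / (A * Y) := ⟨_, rfl⟩
  have hw0 : w ≠ 0 := hw ▸ div_ne_zero hE (mul_ne_zero hA hY)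
  have hEw : E = A * Y * w := by rw [hw]; field_simp
  have hp : q ^ (1 - (N : ℤ)) = F * w := by
    rw [hw]; field_simp; linear_combination -hbal
  have hpq : q ^ (-(N : ℤ)) = F * w / q := by
    rw [← hp, sub_eq_add_neg, zpow_add₀ hq]; field_simp
  have rev : ∀ z, z ≠ 0 → ∀ j ≤ N, qPoch q (F * w / z) j * z ^ j * qPoch q z (N - j) =
      (-1) ^ j * q ^ (j.choose 2) * (F * w) ^ j * qPoch q z N := by
    intro z hz j hj
    have := qPoch_reverse hq hz (N - j) j
    rwa [Nat.sub_add_cancel hj, hp] at this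
  have hg : ∀ j, (-1) ^ j * q ^ (j.choose 2) * (F * w) ^ j ≠ 0 := fun j => by
    have : (-1 : ℂ) ≠ 0 := by norm_num
    positivity
  have hFw : F * w / w = F := by field_simp
  have hwN : qPoch q w N ≠ 0 := by
    have := rev w hw0 N le_rfl
    rw [hFw, Nat.sub_self, qPoch_zero, mul_one] at this
    exact right_ne_zero_of_mul (this ▸ mul_ne_zero hFN (pow_ne_zero _ hw0))
  have term : ∀ m ∈ Finset.range (N + 1),
      qPoch q (q ^ (-(N : ℤ))) m * qPoch q A m * qPoch q Y m * q ^ m /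
        (qPoch q q m * qPoch q E m * qPoch q F m) =
      qPoch q q N / qPoch q w N * saalschutzTerm q A Y w N m := by
    intro m hm
    have hm' : m ≤ N := by simpa [Nat.lt_succ_iff] using hm
    have r1 := rev q hq m hm'
    have r2 := rev w hw0 m hm'
    rw [hFw] at r2
    have h1 := qPoch_ne_zero_of_le hm' hqN
    have h2 := qPoch_ne_zero_of_le (Nat.sub_le N m) hqN
    have h3 := qPoch_ne_zero_of_le hm' hEN
    have h4 := qPoch_ne_zero_of_le hm' hFN
    rw [saalschutzTerm, ← hEw, hpq]
    have key : qPoch q (F * w / q) m * q ^ m * qPoch q q (N - m) * qPoch q w N =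
        qPoch q q N * (qPoch q F m * w ^ m * qPoch q w (N - m)) := by
      rw [r1, r2]; ring
    field_simp
    linear_combination (qPoch q A m * qPoch q Y m) * key
  rw [Finset.sum_congr rfl term, ← Finset.mul_sum, sum_saalschutzTerm hqN (hEw ▸ hEN), ← hEw]
  have r1 := rev w hw0 N le_rfl
  have r2 := rev (w * A) (mul_ne_zero hw0 hA) N le_rfl
  have e1 : F * w / (w * A) = F / A := by field_simp
  have e2 : E / A = w * Y := by rw [hEw]; field_simp
  rw [hFw, Nat.sub_self, qPoch_zero, mul_one] at r1
  rw [e1, Nat.sub_self, qPoch_zero, mul_one, mul_pow] at r2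
  rw [e2]
  have key : qPoch q (w * A) N * qPoch q F N = qPoch q (F / A) N * A ^ N * qPoch q w N := by
    refine mul_left_cancel₀ (mul_ne_zero (hg N) (pow_ne_zero N hw0)) ?_
    linear_combination (-(w ^ N) * qPoch q F N) * r2 + (qPoch q (F / A) N * A ^ N * w ^ N) * r1
  field_simp
  linear_combination qPoch q (w * Y) N * key

lemma two_mul_choose_two_add_self (j : ℕ) : 2 * j.choose 2 + j = j * j := by
  induction j with
  | zero => rfl
  | succ j ih =>
    rw [Nat.choose_succ_succ' j 1, Nat.choose_one_right]
    linarith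

/-- Reversal of both factors `(e/a;q)_n` and `(f/a;q)_n` when `ef = a y q^{1-n}`. -/
lemma qPoch_div_mul_qPoch_div {q a e f y : ℂ} {n : ℕ} (hq : q ≠ 0) (ha : a ≠ 0) (he : e ≠ 0)
    (hf : f ≠ 0) (hbal : e * f = a * y * q ^ (1 - (n : ℤ))) {j : ℕ} (hj : j ≤ n) :
    y ^ j * (a * q ^ j) ^ (n - j) * (qPoch q (e / a) (n - j) * qPoch q (f / a) (n - j)) *
        (qPoch q (a * q ^ (1 - (n : ℤ)) / e) j * qPoch q (a * q ^ (1 - (n : ℤ)) / f) j) =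
      qPoch q (e / a) n * qPoch q (f / a) n * a ^ n := by
  obtain ⟨N, rfl⟩ := Nat.exists_eq_add_of_le' hj
  have hp : q ^ (1 - ((N + j : ℕ) : ℤ)) * q ^ (N + j) = q := by
    rw [← zpow_natCast, ← zpow_add₀ hq]
    simp
  have r1 := qPoch_reverse hq (div_ne_zero he ha) N j
  have r2 := qPoch_reverse hq (div_ne_zero hf ha) N j
  rw [Nat.add_sub_cancel]
  set p := q ^ (1 - ((N + j : ℕ) : ℤ))
  have hp0 : p ≠ 0 := zpow_ne_zero _ hq
  rw [div_div_eq_mul_div, mul_comm p a] at r1 r2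
  have hg : ((-1 : ℂ) ^ j * q ^ (j.choose 2) * p ^ j) ^ 2 * q ^ (j * N) = p ^ j := by
    refine mul_right_cancel₀ (pow_ne_zero j hq) ?_
    have h1 : ((-1 : ℂ) ^ j) ^ 2 = 1 := by rw [← pow_mul, mul_comm, pow_mul]; simp
    calc _ = ((-1 : ℂ) ^ j) ^ 2 * (p ^ j * p ^ j * (q ^ (2 * j.choose 2 + j) * q ^ (j * N))) := by
          ring
      _ = p ^ j * (p * q ^ (N + j)) ^ j := by
          rw [h1, two_mul_choose_two_add_self]; ring
      _ = _ := by rw [hp]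
  have hg0 : (-1 : ℂ) ^ j * q ^ (j.choose 2) * p ^ j ≠ 0 := by
    have : (-1 : ℂ) ≠ 0 := by norm_num
    positivity
  have hef : (e / a) ^ j * (f / a) ^ j * a ^ j = y ^ j * p ^ j := by
    rw [← mul_pow, ← mul_pow, ← mul_pow]
    congr 1
    field_simp
    linear_combination hbal
  set g := (-1 : ℂ) ^ j * q ^ (j.choose 2) * p ^ j
  refine mul_left_cancel₀ (pow_ne_zero 2 hg0) ?_
  calc _ = y ^ j * (g ^ 2 * q ^ (j * N)) * a ^ N *
        (qPoch q (e / a) N * qPoch q (f / a) N) *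
        (qPoch q (a * p / e) j * qPoch q (a * p / f) j) := by ring
    _ = (y ^ j * p ^ j) * a ^ N * (qPoch q (e / a) N * qPoch q (f / a) N) *
        (qPoch q (a * p / e) j * qPoch q (a * p / f) j) := by rw [hg]
    _ = (qPoch q (a * p / e) j * (e / a) ^ j * qPoch q (e / a) N) *
        (qPoch q (a * p / f) j * (f / a) ^ j * qPoch q (f / a) N) * (a ^ j * a ^ N) := by
        rw [← hef]; ring
    _ = _ := by rw [r1, r2]; ring

/-- Sears' first ₄φ₃ transformation. -/
theorem sears_4phi3_first (n : ℕ) (q a b c d e f : ℂ) (hq : q ≠ 0) (ha : a ≠ 0) (hb : b ≠ 0)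
    (hc : c ≠ 0) (hd : d ≠ 0) (he : e ≠ 0) (hf : f ≠ 0)
    (hbal : d * e * f = a * b * c * q ^ (1 - (n : ℤ)))
    (hden1 : ∀ k ≤ n, qPoch q q k * qPoch q d k * qPoch q e k * qPoch q f k ≠ 0)
    (hden2 : ∀ k ≤ n,
      qPoch q (a * q ^ (1 - (n : ℤ)) / e) k * qPoch q (a * q ^ (1 - (n : ℤ)) / f) k ≠ 0) :
    ∑ k ∈ Finset.range (n + 1),
      qPoch q (q ^ (-(n : ℤ))) k * qPoch q a k * qPoch q b k * qPoch q c k * q ^ k /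
        (qPoch q q k * qPoch q d k * qPoch q e k * qPoch q f k)
    = qPoch q (e / a) n * qPoch q (f / a) n / (qPoch q e n * qPoch q f n) * a ^ n *
        ∑ k ∈ Finset.range (n + 1),
          qPoch q (q ^ (-(n : ℤ))) k * qPoch q a k * qPoch q (d / b) k * qPoch q (d / c) k *
            q ^ k /
          (qPoch q q k * qPoch q d k * qPoch q (a * q ^ (1 - (n : ℤ)) / e) k *
            qPoch q (a * q ^ (1 - (n : ℤ)) / f) k) := by
  have hqn : ∀ k ≤ n, qPoch q q k ≠ 0 := fun k hk h => hden1 k hk (by simp [h])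
  have hdn : ∀ k ≤ n, qPoch q d k ≠ 0 := fun k hk h => hden1 k hk (by simp [h])
  have hen : qPoch q e n ≠ 0 := fun h => hden1 n le_rfl (by simp [h])
  have hfn : qPoch q f n ≠ 0 := fun h => hden1 n le_rfl (by simp [h])
  obtain ⟨y, hy⟩ : ∃ y, y = b * c / d := ⟨_, rfl⟩
  have hy0 : y ≠ 0 := hy ▸ div_ne_zero (mul_ne_zero hb hc) hd
  have hbal' : e * f = a * y * q ^ (1 - (n : ℤ)) := by
    rw [hy]
    field_simp
    linear_combination hbal
  have e1 : d / b * (d / c) * y = d := by rw [hy]; field_simp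
  have e2 : y * (d / b) = c := by rw [hy]; field_simp
  have e3 : y * (d / c) = b := by rw [hy]; field_simp
  have expand : ∀ k ∈ Finset.range (n + 1),
      qPoch q (q ^ (-(n : ℤ))) k * qPoch q a k * qPoch q b k * qPoch q c k * q ^ k /
        (qPoch q q k * qPoch q d k * qPoch q e k * qPoch q f k) =
      ∑ j ∈ Finset.range (k + 1), qPoch q (q ^ (-(n : ℤ))) k * qPoch q a k * q ^ k /
        (qPoch q e k * qPoch q f k) * saalschutzTerm q (d / b) (d / c) y k j := by
    intro k hk
    have hk' : k ≤ n := by simpa [Nat.lt_succ_iff] using hk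
    rw [← Finset.mul_sum, sum_saalschutzTerm (hqn k hk') (e1.symm ▸ hdn k hk'), e1, e2, e3,
      div_mul_div_comm]
    congr 1 <;> ring
  rw [Finset.sum_congr rfl expand,
    Finset.sum_comm' (t' := Finset.range (n + 1)) (s' := fun j => Finset.Ico j (n + 1))
      (by intro k j; simp only [Finset.mem_range, Finset.mem_Ico]; omega),
    Finset.mul_sum]
  refine Finset.sum_congr rfl fun j hj => ?_
  have hj' : j ≤ n := by simpa [Nat.lt_succ_iff] using hj
  obtain ⟨N, hN⟩ := Nat.exists_eq_add_of_le hj'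
  have hx := hden2 j hj'
  have hrev := qPoch_div_mul_qPoch_div hq ha he hf hbal' hj'
  have hNj : n - j = N := by omega
  have hqj : q ^ (-(n : ℤ)) * q ^ j = q ^ (-(N : ℤ)) := by
    rw [← zpow_natCast, ← zpow_add₀ hq, hN]
    congr 1
    push_cast
    ring
  have hpj : q ^ (1 - (n : ℤ)) * q ^ j = q ^ (1 - (N : ℤ)) := by
    rw [sub_eq_add_neg, zpow_add₀ hq, mul_assoc, hqj, ← zpow_add₀ hq, ← sub_eq_add_neg]
  have hEe : qPoch q e n = qPoch q e j * qPoch q (e * q ^ j) N := by rw [hN, qPoch_add]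
  have hFf : qPoch q f n = qPoch q f j * qPoch q (f * q ^ j) N := by rw [hN, qPoch_add]
  have hqj0 : q ^ j ≠ 0 := pow_ne_zero j hq
  rw [hEe] at hen
  rw [hFf] at hfn
  have hsum := q_pfaff_saalschutz (N := N) (A := a * q ^ j) (Y := y) (E := e * q ^ j)
    (F := f * q ^ j) hq (mul_ne_zero ha hqj0) hy0 (mul_ne_zero he hqj0) (mul_ne_zero hf hqj0)
    (by rw [← hpj]; linear_combination q ^ j * q ^ j * hbal') (hqn N (by omega))
    (right_ne_zero_of_mul hen) (right_ne_zero_of_mul hfn)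
  rw [mul_div_mul_right _ _ hqj0, mul_div_mul_right _ _ hqj0] at hsum
  have inner : ∀ m ∈ Finset.range (N + 1),
      qPoch q (q ^ (-(n : ℤ))) (j + m) * qPoch q a (j + m) * q ^ (j + m) /
        (qPoch q e (j + m) * qPoch q f (j + m)) *
        saalschutzTerm q (d / b) (d / c) y (j + m) j =
      qPoch q (q ^ (-(n : ℤ))) j * qPoch q a j * qPoch q (d / b) j * qPoch q (d / c) j *
          q ^ j * y ^ j / (qPoch q q j * qPoch q d j * (qPoch q e j * qPoch q f j)) *
        (qPoch q (q ^ (-(N : ℤ))) m * qPoch q (a * q ^ j) m * qPoch q y m * q ^ m /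
          (qPoch q q m * qPoch q (e * q ^ j) m * qPoch q (f * q ^ j) m)) := by
    intro m _
    simp only [saalschutzTerm, e1, Nat.add_sub_cancel_left, qPoch_add, hqj, pow_add]
    rw [div_mul_div_comm, div_mul_div_comm]
    congr 1 <;> ring
  rw [Finset.sum_Ico_eq_sum_range, show n + 1 - j = N + 1 by omega,
    Finset.sum_congr rfl inner, ← Finset.mul_sum, hsum, hEe, hFf, div_mul_div_comm,
    div_mul_eq_mul_div, div_mul_div_comm]
  rw [hNj] at hrev
  have h1 := hqn j hj'
  have h2 := hdn j hj'
  have h3 := mul_ne_zero h1 h2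
  rw [div_eq_div_iff (mul_ne_zero (mul_ne_zero h3 (mul_ne_zero (left_ne_zero_of_mul hen)
      (left_ne_zero_of_mul hfn))) (mul_ne_zero (right_ne_zero_of_mul hen)
      (right_ne_zero_of_mul hfn)))
    (mul_ne_zero (mul_ne_zero hen hfn) (by rw [mul_assoc]; exact mul_ne_zero h3 hx))]
  linear_combination (qPoch q (q ^ (-(n : ℤ))) j * qPoch q a j * qPoch q (d / b) j *
    qPoch q (d / c) j * q ^ j * (qPoch q q j * qPoch q d j) * (qPoch q e j *
    qPoch q (e * q ^ j) N) * (qPoch q f j * qPoch q (f * q ^ j) N)) * hrev
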